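/- Let ω₁, ω₂, ω₃ ∈ ℂ ∖ {0} with Im(ω₁/ω₂) > 0, Im(ω₃/ω₁) > 0 and Im(ω₃/ω₂) > 0, and set q = e^{2πiω₁/ω₂}, p = e^{2πiω₃/ω₂}, r = e^{2πiω₃/ω₁}, q̃ = e^{−2πiω₂/ω₁}, r̃ = e^{−2πiω₁/ω₃}, p̃ = e^{−2πiω₂/ω₃} (all of modulus < 1 under the stated conditions). Then for every u ∈ ℂ at which all three elliptic gamma factors are defined and nonzero, Γ(e^{2πiu/ω₂}; p, q) · Γ(r·e^{−2πiu/ω₁}; q̃, r) = e^{−(πi/3) B_{3,3}(u|ω₁,ω₂,ω₃)} · Γ(e^{−2πiu/ω₃}; r̃, p̃), where B_{3,3}(u|ω₁,ω₂,ω₃) = (1/(ω₁ω₂ω₃))·(u³ − (3u²/2)(ω₁+ω₂+ω₃) + (u/2)((ω₁²+ω₂²+ω₃²) + 3(ω₁ω₂+ω₁ω₃+ω₂ω₃)) − (1/4)(ω₁+ω₂+ω₃)(ω₁ω₂+ω₁ω₃+ω₂ω₃)) is the third Bernoulli polynomial. This is an SL(3,ℤ) modular transformation law for the elliptic gamma function.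 -/

import Mathlib

/-- The infinite q-Pochhammer symbol `(x;p)_∞ = ∏_{j≥0} (1 - x p^j)`. -/
noncomputable def pochInf (x p : ℂ) : ℂ := ∏' j : ℕ, (1 - x * p ^ j)

/-- The elliptic gamma function `Γ(z;p,q)`. -/
noncomputable def ellGamma (z p q : ℂ) : ℂ :=
  ∏' jk : ℕ × ℕ, (1 - z⁻¹ * p ^ (jk.1 + 1) * q ^ (jk.2 + 1)) / (1 - z * p ^ jk.1 * q ^ jk.2)

/-- The third Bernoulli polynomial `B_{3,3}(u|ω₁,ω₂,ω₃)`. -/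
noncomputable def B33 (u ω₁ ω₂ ω₃ : ℂ) : ℂ :=
  (ω₁ * ω₂ * ω₃)⁻¹ *
    (u ^ 3 - 3 * u ^ 2 / 2 * (ω₁ + ω₂ + ω₃) +
      u / 2 * ((ω₁ ^ 2 + ω₂ ^ 2 + ω₃ ^ 2) + 3 * (ω₁ * ω₂ + ω₁ * ω₃ + ω₂ * ω₃)) -
      (ω₁ + ω₂ + ω₃) * (ω₁ * ω₂ + ω₁ * ω₃ + ω₂ * ω₃) / 4)

lemma eg_mul_cancel (f g : ℂ → ℂ) (hf : Differentiable ℂ f) (hg : Differentiable ℂ g)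
    (h : ∀ u, f u * g u = 0) (u₀ : ℂ) (hg0 : g u₀ ≠ 0) : ∀ u, f u = 0 := by
  have hfa : AnalyticOnNhd ℂ f Set.univ := fun x _ => hf.analyticAt x
  have hev : f =ᶠ[nhds u₀] (fun _ => (0 : ℂ)) := by
    have : ∀ᶠ u in nhds u₀, g u ≠ 0 := hg.continuous.continuousAt.eventually_ne hg0
    filter_upwards [this] with u hu
    exact (mul_eq_zero.mp (h u)).resolve_right hu
  have := hfa.eq_of_eventuallyEq (fun x _ => analyticAt_const) hev
  intro u
  exact congrFun this u

lemma eg_coords (w₁ w₂ : ℂ) (hw : (w₁ / w₂).im ≠ 0) (u : ℂ) :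
    ∃ x y : ℝ, u = x * w₁ + y * w₂ := by
  have hw2 : w₂ ≠ 0 := by rintro rfl; simp at hw
  refine ⟨(u / w₂).im / (w₁ / w₂).im,
    (u / w₂).re - (u / w₂).im / (w₁ / w₂).im * (w₁ / w₂).re, ?_⟩
  have key : u / w₂ = ((u / w₂).im / (w₁ / w₂).im : ℝ) * (w₁ / w₂) +
      ((u / w₂).re - (u / w₂).im / (w₁ / w₂).im * (w₁ / w₂).re : ℝ) := by
    apply Complex.ext
    · simp only [Complex.add_re, Complex.re_ofReal_mul, Complex.ofReal_re]; ring
    · simp only [Complex.add_im, Complex.im_ofReal_mul, Complex.ofReal_im]; field_simp; simp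
  calc u = u / w₂ * w₂ := by field_simp
    _ = (((u / w₂).im / (w₁ / w₂).im : ℝ) * (w₁ / w₂) +
      ((u / w₂).re - (u / w₂).im / (w₁ / w₂).im * (w₁ / w₂).re : ℝ)) * w₂ := by rw [← key]
    _ = _ := by rw [add_mul, mul_assoc, div_mul_cancel₀ _ hw2]

lemma eg_const (A B : ℂ → ℂ) (hA : Differentiable ℂ A) (hB : Differentiable ℂ B)
    (w₁ w₂ : ℂ) (hw : (w₁ / w₂).im ≠ 0)
    (h1 : ∀ u, A (u + w₁) * B u = A u * B (u + w₁))
    (h2 : ∀ u, A (u + w₂) * B u = A u * B (u + w₂))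
    (hc : ∀ u, ∃ m n : ℤ, B (u + (m * w₁ + n * w₂)) ≠ 0) :
    ∃ c, ∀ u, A u = c * B u := by
  obtain ⟨m0, n0, hb0⟩ := hc 0
  set b0 := (0 : ℂ) + (m0 * w₁ + n0 * w₂) with hb0d
  let S : AddSubgroup ℂ :=
    { carrier := {l | ∀ u, A (u + l) * B u = A u * B (u + l)}
      zero_mem' := by intro u; simp
      neg_mem' := by
        intro l hl u
        have := hl (u + -l)
        simp only [neg_add_cancel_right] at this
        exact this.symm
      add_mem' := by
        intro l m hl hm
        have := eg_mul_cancel (fun u => A (u + (l + m)) * B u - A u * B (u + (l + m)))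
          (fun u => B (u + l)) (by fun_prop) (by fun_prop) (by
            intro u
            have e1 := hl u
            have e2 := hm (u + l)
            rw [add_assoc] at e2
            linear_combination B u * e2 + B (u + (l + m)) * e1) (b0 - l) (by simpa using hb0)
        intro u
        exact sub_eq_zero.mp (this u) }
  have hS : ∀ m n : ℤ, (m * w₁ + n * w₂ : ℂ) ∈ S := by
    intro m n
    have e1 : w₁ ∈ S := h1
    have e2 : w₂ ∈ S := h2
    have := S.add_mem (S.zsmul_mem e1 m) (S.zsmul_mem e2 n)
    simpa using this
  choose M N hMN using hc
  let lam : ℂ → ℂ := fun u => M u * w₁ + N u * w₂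
  let H : ℂ → ℂ := fun u => A (u + lam u) / B (u + lam u)
  have hH : ∀ u (l : ℂ), l ∈ S → B (u + l) ≠ 0 → H u = A (u + l) / B (u + l) := by
    intro u l hl hb
    have hl' : lam u ∈ S := hS _ _
    have hd : l - lam u ∈ S := S.sub_mem hl hl'
    have := hd (u + lam u)
    have e : u + lam u + (l - lam u) = u + l := by ring
    rw [e] at this
    have hb' : B (u + lam u) ≠ 0 := hMN u
    simp only [H]
    rw [div_eq_div_iff hb' hb]
    exact this.symm
  have hHd : Differentiable ℂ H := by
    intro u₀
    have hb' : B (u₀ + lam u₀) ≠ 0 := hMN u₀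
    have hev : H =ᶠ[nhds u₀] fun u => A (u + lam u₀) / B (u + lam u₀) := by
      have : ∀ᶠ u in nhds u₀, B (u + lam u₀) ≠ 0 := by
        have hcB := hB.continuous
        have : Continuous fun u => B (u + lam u₀) := by fun_prop
        exact this.continuousAt.eventually_ne hb'
      filter_upwards [this] with u hu
      exact hH u _ (hS _ _) hu
    refine DifferentiableAt.congr_of_eventuallyEq ?_ hev
    refine DifferentiableAt.div (by fun_prop) (by fun_prop) hb'
  have hHp : ∀ u (m n : ℤ), H (u + (m * w₁ + n * w₂)) = H u := by
    intro u m n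
    have hb' := hMN (u + (m * w₁ + n * w₂))
    set l' := lam (u + (m * w₁ + n * w₂)) with hl'
    have hm : (m * w₁ + n * w₂) + l' ∈ S := S.add_mem (hS _ _) (hS _ _)
    rw [hH u _ hm (by rw [← add_assoc]; exact hb'), ← add_assoc u _ l']
  have hbd : Bornology.IsBounded (Set.range H) := by
    let f : ℝ × ℝ → ℂ := fun t => H (t.1 * w₁ + t.2 * w₂)
    have hHc := hHd.continuous
    have hf : Continuous f := by fun_prop
    have hK : IsCompact (f '' (Set.Icc (0 : ℝ) 1 ×ˢ Set.Icc (0 : ℝ) 1)) :=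
      (isCompact_Icc.prod isCompact_Icc).image hf
    refine hK.isBounded.subset ?_
    rintro _ ⟨u, rfl⟩
    obtain ⟨x, y, rfl⟩ := eg_coords w₁ w₂ hw u
    refine ⟨(Int.fract x, Int.fract y), ⟨⟨Int.fract_nonneg _, (Int.fract_lt_one _).le⟩,
      ⟨Int.fract_nonneg _, (Int.fract_lt_one _).le⟩⟩, ?_⟩
    simp only [f]
    rw [← hHp _ ⌊x⌋ ⌊y⌋]
    congr 1
    have ex : (x : ℂ) = (⌊x⌋ : ℂ) + (Int.fract x : ℝ) := by
      exact_mod_cast (Int.floor_add_fract x).symm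
    have ey : (y : ℂ) = (⌊y⌋ : ℂ) + (Int.fract y : ℝ) := by
      exact_mod_cast (Int.floor_add_fract y).symm
    rw [ex, ey]
    ring
  obtain ⟨c, hcc⟩ := hHd.exists_const_forall_eq_of_bounded hbd
  refine ⟨c, fun u => ?_⟩
  have hb' : B (u + lam u) ≠ 0 := hMN u
  have e1 : A (u + lam u) / B (u + lam u) = c := hcc u
  have e2 : A (u + lam u) * B u = A u * B (u + lam u) := hS _ _ u
  rw [div_eq_iff hb'] at e1
  rw [e1] at e2
  apply mul_right_cancel₀ hb'
  rw [← e2]; ring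

lemma eg_prod_mult {ι : Type*} (a : ι → ℂ) (ha : Summable fun i => ‖a i‖) (z : ℂ) :
    Multipliable fun i => (1 - z * a i) := by
  have := multipliable_one_add_of_summable (f := fun i => -(z * a i))
    (by simpa using ha.mul_left ‖z‖)
  simpa [sub_eq_add_neg] using this

lemma eg_prod_ne {ι : Type*} (a : ι → ℂ) (ha : Summable fun i => ‖a i‖) (z : ℂ)
    (h : ∀ i, z * a i ≠ 1) : ∏' i, (1 - z * a i) ≠ 0 := by
  have := tprod_one_add_ne_zero_of_summable (f := fun i => -(z * a i))
    (by intro i hi; apply h i; linear_combination -hi) (by simpa using ha.mul_left ‖z‖)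
  simpa [sub_eq_add_neg] using this

lemma eg_prod_diff {ι : Type*} (a : ι → ℂ) (ha : Summable fun i => ‖a i‖) :
    Differentiable ℂ fun z => ∏' i, (1 - z * a i) := by
  have key : HasProdLocallyUniformlyOn (fun i z => 1 + -(z * a i))
      (fun z => ∏' i, (1 + -(z * a i))) (Set.univ : Set ℂ) := by
    apply hasProdLocallyUniformlyOn_of_forall_compact isOpen_univ
    intro K _ hcK
    obtain ⟨C, hC⟩ := hcK.isBounded.exists_norm_le
    refine (ha.mul_left C).hasProdUniformlyOn_one_add hcK
      (.of_forall fun n x hx ↦ ?_) (fun _ ↦ by fun_prop)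
    simpa using mul_le_mul_of_nonneg_right (hC x hx) (norm_nonneg (a n))
  have := key.differentiableOn
    (.of_forall fun _ ↦ by simpa [Finset.prod_fn] using
      DifferentiableOn.finsetProd (fun _ _ ↦ by fun_prop)) isOpen_univ
  simpa [sub_eq_add_neg, differentiableOn_univ] using this

lemma eg_sum1 (p : ℂ) (hp : ‖p‖ < 1) : Summable fun j : ℕ => ‖p ^ j‖ := by
  simpa using summable_geometric_of_lt_one (norm_nonneg _) hp

lemma eg_sum2 (p q : ℂ) (hp : ‖p‖ < 1) (hq : ‖q‖ < 1) :
    Summable fun jk : ℕ × ℕ => ‖p ^ jk.1 * q ^ jk.2‖ :=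
  (eg_sum1 p hp).mul_norm (eg_sum1 q hq)

noncomputable def egD (z p q : ℂ) : ℂ := ∏' jk : ℕ × ℕ, (1 - z * (p ^ jk.1 * q ^ jk.2))

noncomputable def egT (z p : ℂ) : ℂ := pochInf z p * pochInf (p / z) p

lemma egD_symm (z p q : ℂ) : egD z p q = egD z q p := by
  unfold egD
  rw [← (Equiv.prodComm ℕ ℕ).tprod_eq]
  simp [mul_comm]

lemma egD_diff (p q : ℂ) (hp : ‖p‖ < 1) (hq : ‖q‖ < 1) : Differentiable ℂ fun z => egD z p q :=
  eg_prod_diff _ (eg_sum2 p q hp hq)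

lemma pochInf_diff (p : ℂ) (hp : ‖p‖ < 1) : Differentiable ℂ fun z => pochInf z p :=
  eg_prod_diff _ (eg_sum1 p hp)

lemma egD_ne (z p q : ℂ) (hp : ‖p‖ < 1) (hq : ‖q‖ < 1)
    (h : ∀ j k : ℕ, z * p ^ j * q ^ k ≠ 1) : egD z p q ≠ 0 :=
  eg_prod_ne _ (eg_sum2 p q hp hq) z (fun i => by rw [← mul_assoc]; exact h _ _)

lemma egD_ne' (z p q : ℂ) (hp : ‖p‖ < 1) (hq : ‖q‖ < 1) (hz : ‖z‖ < 1) : egD z p q ≠ 0 := by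
  apply egD_ne z p q hp hq
  intro j k h
  have h1 : ‖z * p ^ j * q ^ k‖ < 1 := by
    rw [norm_mul, norm_mul, norm_pow, norm_pow]
    have a1 : ‖p‖ ^ j ≤ 1 := pow_le_one₀ (norm_nonneg _) hp.le
    have a2 : ‖q‖ ^ k ≤ 1 := pow_le_one₀ (norm_nonneg _) hq.le
    calc ‖z‖ * ‖p‖ ^ j * ‖q‖ ^ k ≤ ‖z‖ * 1 * 1 := by gcongr
      _ < 1 := by simpa using hz
  rw [h] at h1
  simp at h1

lemma pochInf_ne (z p : ℂ) (hp : ‖p‖ < 1) (h : ∀ j : ℕ, z * p ^ j ≠ 1) : pochInf z p ≠ 0 :=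
  eg_prod_ne _ (eg_sum1 p hp) z h

lemma pochInf_ne' (z p : ℂ) (hp : ‖p‖ < 1) (hz : ‖z‖ < 1) : pochInf z p ≠ 0 := by
  apply pochInf_ne z p hp
  intro j h
  have h1 : ‖z * p ^ j‖ < 1 := by
    rw [norm_mul, norm_pow]
    have a1 : ‖p‖ ^ j ≤ 1 := pow_le_one₀ (norm_nonneg _) hp.le
    calc ‖z‖ * ‖p‖ ^ j ≤ ‖z‖ * 1 := by gcongr
      _ < 1 := by simpa using hz
  rw [h] at h1
  simp at h1

lemma pochInf_step (z p : ℂ) (hp : ‖p‖ < 1) : pochInf z p = (1 - z) * pochInf (p * z) p := by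
  unfold pochInf
  have e : ∀ b : ℕ, (1 - z * p ^ (b + 1)) = 1 - (p * z) * p ^ b := by intro b; ring
  rw [tprod_eq_zero_mul']
  · simp only [e]; simp
  · simp only [e]; exact eg_prod_mult _ (eg_sum1 p hp) (p * z)

lemma egD_step (z p q : ℂ) (hp : ‖p‖ < 1) (hq : ‖q‖ < 1) :
    egD z p q = pochInf z p * egD (q * z) p q := by
  have hrow : ∀ (z q : ℂ), ‖q‖ < 1 → egD z p q = ∏' j : ℕ, pochInf (z * p ^ j) q := by
    intro z q hq
    unfold egD pochInf
    rw [Multipliable.tprod_prod' (eg_prod_mult _ (eg_sum2 p q hp hq) z)]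
    · simp [mul_assoc]
    · intro b
      simpa [mul_assoc] using eg_prod_mult _ (eg_sum1 q hq) (z * p ^ b)
  have hm : ∀ (z : ℂ), Multipliable fun j : ℕ => pochInf (z * p ^ j) q := by
    intro z
    have := (eg_prod_mult _ (eg_sum2 p q hp hq) z).hasProd.prod_fiberwise
      (g := fun j => pochInf (z * p ^ j) q) (by
        intro b
        have := (eg_prod_mult _ (eg_sum1 q hq) (z * p ^ b)).hasProd
        simpa [mul_assoc, pochInf] using this)
    exact this.multipliable
  rw [hrow z q hq, hrow (q * z) q hq]
  have hz : pochInf z p = ∏' j : ℕ, (1 - z * p ^ j) := rfl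
  rw [hz, ← Multipliable.tprod_mul (eg_prod_mult _ (eg_sum1 p hp) z) (hm _)]
  apply tprod_congr
  intro j
  rw [pochInf_step _ q hq, mul_assoc q]

lemma ellGamma_eq (z p q : ℂ) (hp : ‖p‖ < 1) (hq : ‖q‖ < 1)
    (h : ∀ j k : ℕ, z * p ^ j * q ^ k ≠ 1) :
    ellGamma z p q = egD (p * q / z) p q / egD z p q := by
  have h1 := (eg_prod_mult _ (eg_sum2 p q hp hq) (p * q / z)).hasProd
  have h2 := (eg_prod_mult _ (eg_sum2 p q hp hq) z).hasProd.inv₀ (egD_ne z p q hp hq h)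
  have h3 := (h1.mul h2).tprod_eq
  unfold ellGamma egD
  rw [div_eq_mul_inv, ← h3]
  apply tprod_congr
  intro jk
  rw [← div_eq_mul_inv]
  congr 1 <;> ring

lemma egT_symm (z p : ℂ) (hz : z ≠ 0) (hp0 : p ≠ 0) : egT (p / z) p = egT z p := by
  unfold egT
  rw [div_div_cancel₀ hp0, mul_comm]

lemma egT_step (z p : ℂ) (hp : ‖p‖ < 1) (hz : z ≠ 0) (hp0 : p ≠ 0) :
    -z * egT (p * z) p = egT z p := by
  unfold egT
  rw [pochInf_step z p hp, show p / (p * z) = z⁻¹ by field_simp, pochInf_step z⁻¹ p hp,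
    div_eq_mul_inv]
  field_simp
  ring

lemma egT_half (s p : ℂ) (hs : s ^ 2 = p) (hs0 : s ≠ 0) (hp : ‖p‖ < 1) :
    egT (-1) p * egT s p * egT (-s) p = 2 := by
  have hp2 : ‖p ^ 2‖ < 1 := by
    rw [norm_pow]; exact pow_lt_one₀ (norm_nonneg _) hp two_ne_zero
  have e1 : ∀ x, pochInf x p * pochInf (-x) p = pochInf (x ^ 2) (p ^ 2) := by
    intro x
    unfold pochInf
    rw [← Multipliable.tprod_mul (eg_prod_mult _ (eg_sum1 p hp) x)
      (eg_prod_mult _ (eg_sum1 p hp) (-x))]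
    apply tprod_congr
    intro j
    ring
  have e2 : pochInf p (p ^ 2) * pochInf (p ^ 2) (p ^ 2) = pochInf p p := by
    have := tprod_even_mul_odd (f := fun j : ℕ => 1 - p * p ^ j)
      (by
        have := eg_prod_mult _ (eg_sum1 (p ^ 2) hp2) p
        simpa only [pow_mul] using this)
      (by
        have := eg_prod_mult _ (eg_sum1 (p ^ 2) hp2) (p ^ 2)
        refine this.congr ?_
        intro j; ring)
    unfold pochInf
    rw [← this]
    congr 1
    · simp only [pow_mul]
    · apply tprod_congr; intro j; ring
  have e3 := e1 s
  have e4 := e1 p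
  rw [hs] at e3
  have hne1 : pochInf p p ≠ 0 := pochInf_ne' p p hp hp
  have e5 : pochInf (-p) p * (pochInf s p * pochInf (-s) p) = 1 := by
    apply mul_left_cancel₀ hne1
    rw [e3]
    linear_combination (pochInf p (p ^ 2)) * e4 + e2
  unfold egT
  rw [show p / s = s by rw [← hs]; field_simp, show p / -s = -s by rw [← hs]; field_simp,
    show p / -1 = -p by ring, pochInf_step (-1) p hp, show p * -1 = -p by ring]
  linear_combination 2 * (pochInf (-p) p * (pochInf s p * pochInf (-s) p) + 1) * e5

noncomputable def egE (x : ℂ) : ℂ := Complex.exp (2 * (Real.pi : ℂ) * Complex.I * x)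

lemma egE_add (x y : ℂ) : egE (x + y) = egE x * egE y := by
  unfold egE; rw [← Complex.exp_add]; ring_nf

lemma egE_zero : egE 0 = 1 := by simp [egE]

lemma egE_ne (x : ℂ) : egE x ≠ 0 := Complex.exp_ne_zero _

lemma egE_neg (x : ℂ) : egE (-x) = (egE x)⁻¹ := by
  unfold egE; rw [← Complex.exp_neg]; ring_nf

lemma egE_sub (x y : ℂ) : egE (x - y) = egE x / egE y := by
  rw [sub_eq_add_neg, egE_add, egE_neg, div_eq_mul_inv]

lemma egE_one : egE 1 = 1 := by
  unfold egE; rw [mul_one]; exact Complex.exp_two_pi_mul_I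

lemma egE_half : egE (1 / 2) = -1 := by
  unfold egE
  rw [show 2 * (Real.pi : ℂ) * Complex.I * (1 / 2) = Real.pi * Complex.I by ring]
  exact Complex.exp_pi_mul_I

lemma egE_pow (x : ℂ) (n : ℕ) : egE x ^ n = egE (n * x) := by
  unfold egE; rw [← Complex.exp_nat_mul]; ring_nf

lemma egE_eq_one (x : ℂ) (h : egE x = 1) : ∃ n : ℤ, x = n := by
  unfold egE at h
  rw [Complex.exp_eq_one_iff] at h
  obtain ⟨n, hn⟩ := h
  refine ⟨n, ?_⟩
  have : (2 * (Real.pi : ℂ) * Complex.I) ≠ 0 := Complex.two_pi_I_ne_zero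
  apply mul_left_cancel₀ this
  rw [hn]; ring

lemma egE_norm (x : ℂ) (h : 0 < x.im) : ‖egE x‖ < 1 := by
  unfold egE
  rw [Complex.norm_exp, Real.exp_lt_one_iff]
  have : (2 * (Real.pi : ℂ) * Complex.I * x).re = -(2 * Real.pi * x.im) := by
    simp [Complex.mul_re]
  rw [this]
  have := Real.pi_pos
  have : 0 < 2 * Real.pi * x.im := by positivity
  linarith

lemma egE_diff : Differentiable ℂ egE := by
  unfold egE; fun_prop

lemma egE_diff' (f : ℂ → ℂ) (hf : Differentiable ℂ f) : Differentiable ℂ fun u => egE (f u) :=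
  egE_diff.comp hf

noncomputable def egB (u w w' : ℂ) : ℂ :=
  (u ^ 2 - (w + w') * u + (w ^ 2 + w' ^ 2 + 3 * w * w') / 6) / (w * w')

lemma eg_neg_im (w w' : ℂ) (him : 0 < (w' / w).im) : 0 < (-(w / w')).im := by
  have hne : w' / w ≠ 0 := by intro h; rw [h] at him; simp at him
  rw [← inv_div, Complex.neg_im, Complex.inv_im, neg_div, neg_neg]
  exact div_pos him (Complex.normSq_pos.mpr hne)

lemma eg_theta (w w' : ℂ) (hw : w ≠ 0) (hw' : w' ≠ 0) (him : 0 < (w' / w).im) :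
    ∃ c : ℂ, c ^ 3 = 1 ∧ ∀ u, egT (egE (u / w)) (egE (w' / w)) =
      c * (egE (-(egB u w w') / 2) * egT (egE (-(u / w'))) (egE (-(w / w')))) := by
  have him' := eg_neg_im w w' him
  set p := egE (w' / w) with hpd
  set p' := egE (-(w / w')) with hpd'
  have hp : ‖p‖ < 1 := egE_norm _ him
  have hp' : ‖p'‖ < 1 := egE_norm _ him'
  have hp0 : p ≠ 0 := egE_ne _
  have hp0' : p' ≠ 0 := egE_ne _
  let A : ℂ → ℂ := fun u => egT (egE (u / w)) p
  let F : ℂ → ℂ := fun u => egE (-(egB u w w') / 2)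
  let B : ℂ → ℂ := fun u => F u * egT (egE (-(u / w'))) p'
  let R : ℂ → ℂ := fun u => F u *
    (pochInf (p' * egE (-(u / w'))) p' * pochInf (egE ((u - w) / w')) p')
  have hP := pochInf_diff p hp
  have hP' := pochInf_diff p' hp'
  have hFd : Differentiable ℂ F := egE_diff' _ (by unfold egB; fun_prop)
  have hA : Differentiable ℂ A := by
    have e : A = fun u => pochInf (egE (u / w)) p * pochInf (egE ((w' - u) / w)) p := by
      funext u
      simp only [A, egT]
      rw [sub_div, egE_sub]
    rw [e]
    exact (hP.comp (egE_diff' _ (by fun_prop))).mul (hP.comp (egE_diff' _ (by fun_prop)))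
  have hR : Differentiable ℂ R := by
    refine hFd.mul ((hP'.comp ?_).mul (hP'.comp (egE_diff' _ (by fun_prop))))
    exact (egE_diff' _ (by fun_prop)).const_mul _
  have hBR : ∀ u, B u = (1 - egE (-(u / w'))) * R u := by
    intro u
    simp only [B, R, egT]
    rw [pochInf_step _ p' hp', show (u - w) / w' = -(w / w') - (-(u / w')) by ring, egE_sub]
    ring
  have hB : Differentiable ℂ B := by
    have e : B = fun u => (1 - egE (-(u / w'))) * R u := funext hBR
    rw [e]
    exact ((egE_diff' _ (by fun_prop)).const_sub _).mul hR
  have hA0 : A 0 = 0 := by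
    simp only [A, egT]
    rw [pochInf_step _ p hp]
    simp [egE_zero]
  have hB0 : B 0 = 0 := by rw [hBR]; simp [egE_zero]
  have hR0 : R 0 ≠ 0 := by
    simp only [R]
    refine mul_ne_zero (egE_ne _) (mul_ne_zero ?_ ?_)
    · simp only [zero_div, neg_zero, egE_zero, mul_one]
      exact pochInf_ne' _ _ hp' hp'
    · rw [show (0 - w) / w' = -(w / w') by ring]
      exact pochInf_ne' _ _ hp' hp'
  have hdB : deriv B 0 ≠ 0 := by
    have h1 : HasDerivAt (fun u : ℂ => 1 - egE (-(u / w')))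
        (2 * (Real.pi : ℂ) * Complex.I / w') 0 := by
      have h0 : HasDerivAt (fun u : ℂ => 2 * (Real.pi : ℂ) * Complex.I * (-(u / w')))
          (2 * (Real.pi : ℂ) * Complex.I * (-(1 / w'))) 0 :=
        (((hasDerivAt_id (0 : ℂ)).div_const w').neg).const_mul _
      have h2 := (h0.cexp).const_sub 1
      unfold egE
      refine h2.congr_deriv ?_
      rw [zero_div, neg_zero, mul_zero, Complex.exp_zero]
      ring
    have h2 := h1.mul (hR 0).hasDerivAt
    have e : B = fun u => (1 - egE (-(u / w'))) * R u := funext hBR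
    have h3 : deriv B 0 = 2 * (Real.pi : ℂ) * Complex.I / w' * R 0 := by
      rw [e]
      refine h2.deriv.trans ?_
      simp [egE_zero]
    rw [h3]
    exact mul_ne_zero (div_ne_zero Complex.two_pi_I_ne_zero hw') hR0
  have hAw : ∀ u, A (u + w) = A u := by
    intro u
    simp only [A]
    rw [add_div, div_self hw, egE_add, egE_one, mul_one]
  have hBw : ∀ u, B (u + w) = B u := by
    intro u
    have e1 : egE (-((u + w) / w')) = p' * egE (-(u / w')) := by
      rw [hpd', ← egE_add]; congr 1; ring
    have e2 : F (u + w) = F u * (-egE (-(u / w'))) := by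
      simp only [F]
      have : -egE (-(u / w')) = egE (1 / 2 + -(u / w')) := by rw [egE_add, egE_half]; ring
      rw [this, ← egE_add]
      congr 1
      unfold egB
      field_simp
      ring
    simp only [B]
    rw [e1, e2, ← egT_step (egE (-(u / w'))) p' hp' (egE_ne _) hp0']
    ring
  have hAw' : ∀ u, -egE (u / w) * A (u + w') = A u := by
    intro u
    simp only [A]
    rw [add_div, egE_add, ← hpd, mul_comm (egE (u / w)) p]
    exact egT_step _ p hp (egE_ne _) hp0
  have hBw' : ∀ u, -egE (u / w) * B (u + w') = B u := by
    intro u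
    have e1 : egE (-((u + w') / w')) = egE (-(u / w')) := by
      rw [show -((u + w') / w') = -(u / w') - 1 by field_simp; ring, egE_sub, egE_one, div_one]
    have e2 : -egE (u / w) * F (u + w') = F u := by
      simp only [F]
      have : -egE (u / w) = egE (-(1 / 2) + (u / w)) := by
        rw [egE_add, egE_neg, egE_half]; norm_num
      rw [this, ← egE_add]
      congr 1
      unfold egB
      field_simp
      ring
    simp only [B]
    rw [e1, ← mul_assoc, e2]
  let a := dslope A 0
  let b := dslope B 0
  have ha : Differentiable ℂ a := by
    rw [← differentiableOn_univ]
    exact (Complex.differentiableOn_dslope Filter.univ_mem).mpr hA.differentiableOn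
  have hb : Differentiable ℂ b := by
    rw [← differentiableOn_univ]
    exact (Complex.differentiableOn_dslope Filter.univ_mem).mpr hB.differentiableOn
  have hAa : ∀ u, A u = u * a u := by
    intro u
    have := sub_smul_dslope A 0 u
    simp only [sub_zero, hA0, smul_eq_mul] at this
    exact this.symm
  have hBb : ∀ u, B u = u * b u := by
    intro u
    have := sub_smul_dslope B 0 u
    simp only [sub_zero, hB0, smul_eq_mul] at this
    exact this.symm
  have hb0 : b 0 ≠ 0 := by
    simp only [b, dslope_same]; exact hdB
  have hper : ∀ l, l ≠ 0 → (∀ u, A (u + l) * B u = A u * B (u + l)) →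
      ∀ u, a (u + l) * b u = a u * b (u + l) := by
    intro l hl h u
    have := eg_mul_cancel (fun u => a (u + l) * b u - a u * b (u + l)) (fun u => u * (u + l))
      (by fun_prop) (by fun_prop) (by
        intro u
        have h' := h u
        rw [hAa, hBb, hAa u, hBb (u + l)] at h'
        linear_combination h') l (by
          refine mul_ne_zero hl ?_
          rw [← two_mul]; exact mul_ne_zero two_ne_zero hl) u
    exact sub_eq_zero.mp this
  have hBne : ∀ u, (∀ m n : ℤ, u + (m * w' + n * w) ≠ 0) → B u ≠ 0 := by
    intro u hu
    refine mul_ne_zero (egE_ne _) (mul_ne_zero ?_ ?_)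
    · apply pochInf_ne _ _ hp'
      intro j hj
      rw [hpd', egE_pow, ← egE_add] at hj
      obtain ⟨n, hn⟩ := egE_eq_one _ hj
      apply hu n j
      field_simp at hn
      push_cast
      linear_combination -hn
    · apply pochInf_ne _ _ hp'
      intro j hj
      rw [hpd', egE_pow, ← egE_sub, ← egE_add] at hj
      obtain ⟨n, hn⟩ := egE_eq_one _ hj
      apply hu (-n) (-(j + 1))
      field_simp at hn
      push_cast
      linear_combination hn
  obtain ⟨c, hc⟩ := eg_const a b ha hb w' w him.ne'
    (hper w' hw' (by
      intro u
      rw [← hAw' u, ← hBw' u]; ring))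
    (hper w hw (by intro u; rw [hAw, hBw]))
    (by
      intro u
      by_cases h : ∃ m n : ℤ, u + (m * w' + n * w) = 0
      · obtain ⟨m, n, h⟩ := h
        exact ⟨m, n, by rw [h]; exact hb0⟩
      · push Not at h
        refine ⟨0, 0, ?_⟩
        have := hBne u h
        rw [hBb] at this
        simpa using right_ne_zero_of_mul this)
  have hAB : ∀ u, A u = c * B u := by
    intro u; rw [hAa, hBb, hc]; ring
  refine ⟨c, ?_, hAB⟩
  have hs := egT_half (egE (w' / w / 2)) p (by
    rw [egE_pow, hpd]; congr 1; push_cast; ring) (egE_ne _) hp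
  have hs' := egT_half (egE (-(w / w') / 2)) p' (by
    rw [egE_pow, hpd']; congr 1; push_cast; ring) (egE_ne _) hp'
  have k1 := hAB (w / 2)
  have k2 := hAB (w' / 2)
  have k3 := hAB ((w + w') / 2)
  have m1 : egE (w / 2 / w) = -1 := by
    rw [← egE_half]; congr 1; field_simp
  have m2 : egE (w' / 2 / w) = egE (w' / w / 2) := by congr 1; ring
  have m3 : egE ((w + w') / 2 / w) = -egE (w' / w / 2) := by
    have : -egE (w' / w / 2) = egE (1 / 2 + w' / w / 2) := by rw [egE_add, egE_half]; ring
    rw [this]; congr 1; field_simp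
  have m4 : egE (-(w / 2 / w')) = egE (-(w / w') / 2) := by congr 1; ring
  have m5 : egE (-(w' / 2 / w')) = -1 := by
    rw [show -(w' / 2 / w') = -(1 / 2 : ℂ) by field_simp, egE_neg, egE_half]; norm_num
  have m6 : egE (-((w + w') / 2 / w')) = -egE (-(w / w') / 2) := by
    have : -egE (-(w / w') / 2) = egE (-(1 / 2) + -(w / w') / 2) := by
      rw [egE_add, egE_neg, egE_half]; norm_num
    rw [this]; congr 1; field_simp; ring
  have hF : F (w / 2) * F (w' / 2) * F ((w + w') / 2) = 1 := by
    simp only [F]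
    rw [← egE_add, ← egE_add, ← egE_zero]
    congr 1
    unfold egB
    field_simp
    ring
  simp only [A, B] at k1 k2 k3
  rw [m1, m4] at k1
  rw [m2, m5] at k2
  rw [m3, m6] at k3
  rw [k1, k2, k3] at hs
  have h2 : (2 : ℂ) * c ^ 3 = 2 := by
    linear_combination hs - c ^ 3 * 2 * hF - c ^ 3 * F (w / 2) * F (w' / 2) * F ((w + w') / 2) * hs'
  linear_combination h2 / 2

lemma egD_step' (z p q : ℂ) (hp : ‖p‖ < 1) (hq : ‖q‖ < 1) :
    egD z p q = pochInf z q * egD (p * z) p q := by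
  rw [egD_symm z, egD_step z q p hq hp, egD_symm _ q p]

lemma egB33_one (u ω₁ ω₂ ω₃ : ℂ) (h1 : ω₁ ≠ 0) (h2 : ω₂ ≠ 0) (h3 : ω₃ ≠ 0) :
    B33 (u + ω₁) ω₁ ω₂ ω₃ = B33 u ω₁ ω₂ ω₃ + 3 * egB u ω₂ ω₃ := by
  unfold B33 egB
  field_simp
  ring

lemma egB33_two (u ω₁ ω₂ ω₃ : ℂ) (h1 : ω₁ ≠ 0) (h2 : ω₂ ≠ 0) (h3 : ω₃ ≠ 0) :
    B33 (u + ω₂) ω₁ ω₂ ω₃ = B33 u ω₁ ω₂ ω₃ + 3 * egB u ω₁ ω₃ := by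
  unfold B33 egB
  field_simp
  ring

lemma egB33_mid (ω₁ ω₂ ω₃ : ℂ) : B33 ((ω₁ + ω₂ + ω₃) / 2) ω₁ ω₂ ω₃ = 0 := by
  unfold B33
  ring

lemma eg_entire (ω₁ ω₂ ω₃ : ℂ)
    (hω₁ : ω₁ ≠ 0) (hω₂ : ω₂ ≠ 0) (hω₃ : ω₃ ≠ 0)
    (him12 : 0 < (ω₁ / ω₂).im) (him31 : 0 < (ω₃ / ω₁).im) (him32 : 0 < (ω₃ / ω₂).im) (u : ℂ) :
    egD (egE ((ω₁ + ω₃ - u) / ω₂)) (egE (ω₃ / ω₂)) (egE (ω₁ / ω₂)) *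
      egD (egE ((u - ω₂) / ω₁)) (egE (-(ω₂ / ω₁))) (egE (ω₃ / ω₁)) *
      egD (egE (-(u / ω₃))) (egE (-(ω₁ / ω₃))) (egE (-(ω₂ / ω₃))) =
    egE (-(B33 u ω₁ ω₂ ω₃) / 6) *
      egD (egE ((u - ω₁ - ω₂) / ω₃)) (egE (-(ω₁ / ω₃))) (egE (-(ω₂ / ω₃))) *
      egD (egE (u / ω₂)) (egE (ω₃ / ω₂)) (egE (ω₁ / ω₂)) *
      egD (egE ((ω₃ - u) / ω₁)) (egE (-(ω₂ / ω₁))) (egE (ω₃ / ω₁)) := by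
  have i21 := eg_neg_im ω₂ ω₁ him12
  have i13 := eg_neg_im ω₁ ω₃ him31
  have i23 := eg_neg_im ω₂ ω₃ him32
  obtain ⟨c₁, hc₁, ht₁⟩ := eg_theta ω₂ ω₃ hω₂ hω₃ him32
  obtain ⟨c₂, hc₂, ht₂⟩ := eg_theta ω₁ ω₃ hω₁ hω₃ him31
  set p := egE (ω₃ / ω₂) with hpd
  set q := egE (ω₁ / ω₂) with hqd
  set r := egE (ω₃ / ω₁) with hrd
  set q' := egE (-(ω₂ / ω₁)) with hqd'
  set r' := egE (-(ω₁ / ω₃)) with hrd'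
  set p' := egE (-(ω₂ / ω₃)) with hpd'
  have hp : ‖p‖ < 1 := egE_norm _ him32
  have hq : ‖q‖ < 1 := egE_norm _ him12
  have hr : ‖r‖ < 1 := egE_norm _ him31
  have hq' : ‖q'‖ < 1 := egE_norm _ i21
  have hr' : ‖r'‖ < 1 := egE_norm _ i13
  have hp' : ‖p'‖ < 1 := egE_norm _ i23
  let D1 : ℂ → ℂ := fun u => egD (egE (u / ω₂)) p q
  let N1 : ℂ → ℂ := fun u => egD (egE ((ω₁ + ω₃ - u) / ω₂)) p q
  let D2 : ℂ → ℂ := fun u => egD (egE ((ω₃ - u) / ω₁)) q' r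
  let N2 : ℂ → ℂ := fun u => egD (egE ((u - ω₂) / ω₁)) q' r
  let D3 : ℂ → ℂ := fun u => egD (egE (-(u / ω₃))) r' p'
  let N3 : ℂ → ℂ := fun u => egD (egE ((u - ω₁ - ω₂) / ω₃)) r' p'
  let F : ℂ → ℂ := fun u => egE (-(B33 u ω₁ ω₂ ω₃) / 6)
  let A : ℂ → ℂ := fun u => N1 u * N2 u * D3 u
  let B : ℂ → ℂ := fun u => F u * N3 u * D1 u * D2 u
  change A u = B u
  have hg1 := egD_diff p q hp hq
  have hg2 := egD_diff q' r hq' hr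
  have hg3 := egD_diff r' p' hr' hp'
  have dD1 : Differentiable ℂ D1 := hg1.comp (egE_diff' _ (by fun_prop))
  have dN1 : Differentiable ℂ N1 := hg1.comp (egE_diff' _ (by fun_prop))
  have dD2 : Differentiable ℂ D2 := hg2.comp (egE_diff' _ (by fun_prop))
  have dN2 : Differentiable ℂ N2 := hg2.comp (egE_diff' _ (by fun_prop))
  have dD3 : Differentiable ℂ D3 := hg3.comp (egE_diff' _ (by fun_prop))
  have dN3 : Differentiable ℂ N3 := hg3.comp (egE_diff' _ (by fun_prop))
  have dF : Differentiable ℂ F := egE_diff' _ (by unfold B33; fun_prop)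
  have dA : Differentiable ℂ A := by fun_prop
  have dB : Differentiable ℂ B := by fun_prop
  -- shift by ω₁
  have s1 : ∀ u, A (u + ω₁) * B u = c₁ * (A u * B (u + ω₁)) := by
    intro u
    have a1 : N1 (u + ω₁) = pochInf (p / egE (u / ω₂)) p * N1 u := by
      simp only [N1]
      rw [egD_step _ p q hp hq, hpd, ← egE_sub, ← hpd, hqd, ← egE_add, ← hqd]
      congr 3 <;> ring_nf
    have a2 : D1 u = pochInf (egE (u / ω₂)) p * D1 (u + ω₁) := by
      simp only [D1]
      rw [egD_step _ p q hp hq]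
      rw [hqd, ← egE_add, ← hqd]
      congr 3; ring
    have a3 : N2 (u + ω₁) = N2 u := by
      simp only [N2]
      rw [show (u + ω₁ - ω₂) / ω₁ = (u - ω₂) / ω₁ + 1 by field_simp; ring, egE_add, egE_one,
        mul_one]
    have a4 : D2 (u + ω₁) = D2 u := by
      simp only [D2]
      rw [show (ω₃ - (u + ω₁)) / ω₁ = (ω₃ - u) / ω₁ - 1 by field_simp; ring, egE_sub, egE_one,
        div_one]
    have a5 : N3 (u + ω₁) = pochInf (p' / egE (-(u / ω₃))) p' * N3 u := by
      simp only [N3]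
      rw [egD_step' _ r' p' hr' hp', hpd', ← egE_sub, ← hpd', hrd', ← egE_add, ← hrd']
      congr 3 <;> ring_nf
    have a6 : D3 u = pochInf (egE (-(u / ω₃))) p' * D3 (u + ω₁) := by
      simp only [D3]
      rw [egD_step' _ r' p' hr' hp']
      rw [hrd', ← egE_add, ← hrd']
      congr 3; ring
    have a7 : F (u + ω₁) = F u * egE (-(egB u ω₂ ω₃) / 2) := by
      simp only [F]
      rw [egB33_one u ω₁ ω₂ ω₃ hω₁ hω₂ hω₃, ← egE_add]
      congr 1; ring
    have a8 := ht₁ u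
    unfold egT at a8
    simp only [A, B]
    rw [a1, a2, a3, a4, a5, a6, a7]
    linear_combination (N1 u * N2 u * D3 (u + ω₁) * F u * N3 u * D1 (u + ω₁) * D2 u) * a8
  have s2 : ∀ u, A (u + ω₂) * B u = c₂ * (A u * B (u + ω₂)) := by
    intro u
    have a1 : N2 (u + ω₂) = pochInf (egE (u / ω₁)) r * N2 u := by
      simp only [N2]
      rw [egD_step' _ q' r hq' hr, hqd', ← egE_add, ← hqd']
      congr 3 <;> ring_nf
    have a2 : D2 u = pochInf (r / egE (u / ω₁)) r * D2 (u + ω₂) := by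
      simp only [D2]
      rw [egD_step' _ q' r hq' hr]
      rw [hqd', ← egE_add, ← hqd', hrd, ← egE_sub, ← hrd]
      congr 3 <;> ring_nf
    have a3 : N1 (u + ω₂) = N1 u := by
      simp only [N1]
      rw [show (ω₁ + ω₃ - (u + ω₂)) / ω₂ = (ω₁ + ω₃ - u) / ω₂ - 1 by field_simp; ring, egE_sub,
        egE_one, div_one]
    have a4 : D1 (u + ω₂) = D1 u := by
      simp only [D1]
      rw [show (u + ω₂) / ω₂ = u / ω₂ + 1 by field_simp, egE_add, egE_one,
        mul_one]
    have a5 : N3 (u + ω₂) = pochInf (r' / egE (-(u / ω₃))) r' * N3 u := by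
      simp only [N3]
      rw [egD_step _ r' p' hr' hp', hrd', ← egE_sub, ← hrd', hpd', ← egE_add, ← hpd']
      congr 3 <;> ring_nf
    have a6 : D3 u = pochInf (egE (-(u / ω₃))) r' * D3 (u + ω₂) := by
      simp only [D3]
      rw [egD_step _ r' p' hr' hp']
      rw [hpd', ← egE_add, ← hpd']
      congr 3; ring
    have a7 : F (u + ω₂) = F u * egE (-(egB u ω₁ ω₃) / 2) := by
      simp only [F]
      rw [egB33_two u ω₁ ω₂ ω₃ hω₁ hω₂ hω₃, ← egE_add]
      congr 1; ring
    have a8 := ht₂ u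
    unfold egT at a8
    simp only [A, B]
    rw [a1, a2, a3, a4, a5, a6, a7]
    linear_combination (N1 u * N2 u * D3 (u + ω₂) * F u * N3 u * D1 u * D2 (u + ω₂)) * a8
  have hBne : ∀ u : ℂ, 0 < (u / ω₂).im → 0 < ((ω₃ - u) / ω₁).im →
      0 < ((u - ω₁ - ω₂) / ω₃).im → B u ≠ 0 := by
    intro u h1 h2 h3
    exact mul_ne_zero (mul_ne_zero (mul_ne_zero (egE_ne _)
      (egD_ne' _ _ _ hr' hp' (egE_norm _ h3))) (egD_ne' _ _ _ hp hq (egE_norm _ h1)))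
      (egD_ne' _ _ _ hq' hr (egE_norm _ h2))
  have ineg : ∀ x : ℂ, (-x).im = -x.im := Complex.neg_im
  rw [ineg] at i21 i13 i23
  obtain ⟨c, hc⟩ := eg_const (fun u => A u ^ 3) (fun u => B u ^ 3) (dA.pow 3) (dB.pow 3) ω₁ ω₂
    him12.ne'
    (by
      intro u
      have := congrArg (fun x => x ^ 3) (s1 u)
      simp only [mul_pow, hc₁, one_mul] at this
      exact this)
    (by
      intro u
      have := congrArg (fun x => x ^ 3) (s2 u)
      simp only [mul_pow, hc₂, one_mul] at this
      exact this)
    (by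
      intro u
      obtain ⟨x, y, rfl⟩ := eg_coords ω₁ ω₂ him12.ne' u
      refine ⟨1 - ⌈x⌉, -⌊y⌋, pow_ne_zero 3 ?_⟩
      set x' : ℝ := x + 1 - ⌈x⌉ with hx'
      set y' : ℝ := y - ⌊y⌋ with hy'
      have e : (x : ℂ) * ω₁ + y * ω₂ + (((1 - ⌈x⌉ : ℤ) : ℂ) * ω₁ + ((-⌊y⌋ : ℤ) : ℂ) * ω₂) =
          x' * ω₁ + y' * ω₂ := by
        rw [hx', hy']; push_cast; ring
      rw [e]
      have bx1 : 0 < x' := by have := Int.ceil_lt_add_one x; rw [hx']; linarith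
      have bx2 : 0 ≤ 1 - x' := by have := Int.le_ceil x; rw [hx']; linarith
      have by1 : 0 ≤ y' := by have := Int.floor_le y; rw [hy']; linarith
      have by2 : 0 < 1 - y' := by have := Int.lt_floor_add_one y; rw [hy']; linarith
      apply hBne
      · rw [show (x' * ω₁ + y' * ω₂) / ω₂ = x' * (ω₁ / ω₂) + (y' : ℂ) by field_simp]
        rw [Complex.add_im, Complex.im_ofReal_mul, Complex.ofReal_im, add_zero]
        positivity
      · rw [show (ω₃ - (x' * ω₁ + y' * ω₂)) / ω₁ = ω₃ / ω₁ - (y' : ℂ) * (ω₂ / ω₁) - (x' : ℂ) by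
          field_simp; ring]
        rw [Complex.sub_im, Complex.sub_im, Complex.im_ofReal_mul, Complex.ofReal_im]
        nlinarith
      · rw [show (x' * ω₁ + y' * ω₂ - ω₁ - ω₂) / ω₃ =
          -(((1 - x' : ℝ) : ℂ) * (ω₁ / ω₃)) - ((1 - y' : ℝ) : ℂ) * (ω₂ / ω₃) by
          push_cast; field_simp; ring]
        rw [Complex.sub_im, Complex.neg_im, Complex.im_ofReal_mul, Complex.im_ofReal_mul]
        nlinarith)
  -- the midpoint
  set mid : ℂ := (ω₁ + ω₂ + ω₃) / 2 with hmid
  have hBm : B mid ≠ 0 := by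
    have half : ∀ x : ℂ, (x / 2).im = x.im / 2 := fun x => by
      have := Complex.div_ofNat_im x 2
      simpa using this
    apply hBne
    · rw [show mid / ω₂ = (ω₁ / ω₂ + ω₃ / ω₂ + 1) / 2 by rw [hmid]; field_simp; ring, half]
      simp only [Complex.add_im, Complex.one_im]; linarith
    · rw [show (ω₃ - mid) / ω₁ = (ω₃ / ω₁ - ω₂ / ω₁ - 1) / 2 by rw [hmid]; field_simp; ring, half]
      simp only [Complex.sub_im, Complex.one_im]; linarith
    · rw [show (mid - ω₁ - ω₂) / ω₃ = (1 - ω₁ / ω₃ - ω₂ / ω₃) / 2 by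
        rw [hmid]; field_simp; ring, half]
      simp only [Complex.sub_im, Complex.one_im]; linarith
  have hABm : A mid = B mid := by
    have b1 : N1 mid = D1 mid := by
      simp only [N1, D1]
      rw [show mid / ω₂ = (ω₁ + ω₃ - mid) / ω₂ + 1 by rw [hmid]; field_simp; ring, egE_add,
        egE_one, mul_one]
    have b2 : N2 mid = D2 mid := by
      simp only [N2, D2]
      rw [show (mid - ω₂) / ω₁ = (ω₃ - mid) / ω₁ + 1 by rw [hmid]; field_simp; ring, egE_add,
        egE_one, mul_one]
    have b3 : N3 mid = D3 mid := by
      simp only [N3, D3]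
      rw [show (mid - ω₁ - ω₂) / ω₃ = -(mid / ω₃) + 1 by rw [hmid]; field_simp; ring, egE_add,
        egE_one, mul_one]
    have b4 : F mid = 1 := by
      simp only [F]
      rw [hmid, egB33_mid, neg_zero, zero_div, egE_zero]
    simp only [A, B]
    rw [b1, b2, b3, b4]; ring
  have hc1 : c = 1 := by
    have := hc mid
    rw [hABm] at this
    exact (mul_eq_right₀ (pow_ne_zero 3 hBm)).mp this.symm
  have hfin := eg_mul_cancel (fun u => A u - B u) (fun u => A u ^ 2 + A u * B u + B u ^ 2)
    (by fun_prop) (by fun_prop) (by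
      intro u
      have := hc u
      rw [hc1] at this
      linear_combination this) mid (by
        rw [hABm]
        have : B mid ^ 2 + B mid * B mid + B mid ^ 2 = 3 * B mid ^ 2 := by ring
        rw [this]
        exact mul_ne_zero (by norm_num) (pow_ne_zero 2 hBm)) u
  exact sub_eq_zero.mp hfin

/-- An `SL(3,ℤ)` modular transformation law for the elliptic gamma function:
with `q = e^{2πiω₁/ω₂}`, `p = e^{2πiω₃/ω₂}`, `r = e^{2πiω₃/ω₁}`,
`q̃ = e^{-2πiω₂/ω₁}`, `r̃ = e^{-2πiω₁/ω₃}`, `p̃ = e^{-2πiω₂/ω₃}`, one has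
`Γ(e^{2πiu/ω₂};p,q) Γ(r e^{-2πiu/ω₁};q̃,r)
  = e^{-(πi/3) B_{3,3}(u|ω₁,ω₂,ω₃)} Γ(e^{-2πiu/ω₃};r̃,p̃)`. -/
theorem ellGamma_modular_transformation (ω₁ ω₂ ω₃ : ℂ)
    (hω₁ : ω₁ ≠ 0) (hω₂ : ω₂ ≠ 0) (hω₃ : ω₃ ≠ 0)
    (him12 : 0 < (ω₁ / ω₂).im) (him31 : 0 < (ω₃ / ω₁).im) (him32 : 0 < (ω₃ / ω₂).im)
    (u : ℂ)
    (hdef1 : ∀ j k : ℕ,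
      Complex.exp (2 * (Real.pi : ℂ) * Complex.I * u / ω₂) *
        Complex.exp (2 * (Real.pi : ℂ) * Complex.I * ω₃ / ω₂) ^ j *
        Complex.exp (2 * (Real.pi : ℂ) * Complex.I * ω₁ / ω₂) ^ k ≠ 1)
    (hnz1 : ellGamma (Complex.exp (2 * (Real.pi : ℂ) * Complex.I * u / ω₂))
        (Complex.exp (2 * (Real.pi : ℂ) * Complex.I * ω₃ / ω₂))
        (Complex.exp (2 * (Real.pi : ℂ) * Complex.I * ω₁ / ω₂)) ≠ 0)
    (hdef2 : ∀ j k : ℕ,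
      Complex.exp (2 * (Real.pi : ℂ) * Complex.I * ω₃ / ω₁) *
          Complex.exp (-(2 * (Real.pi : ℂ) * Complex.I) * u / ω₁) *
        Complex.exp (-(2 * (Real.pi : ℂ) * Complex.I) * ω₂ / ω₁) ^ j *
        Complex.exp (2 * (Real.pi : ℂ) * Complex.I * ω₃ / ω₁) ^ k ≠ 1)
    (hnz2 : ellGamma (Complex.exp (2 * (Real.pi : ℂ) * Complex.I * ω₃ / ω₁) *
          Complex.exp (-(2 * (Real.pi : ℂ) * Complex.I) * u / ω₁))
        (Complex.exp (-(2 * (Real.pi : ℂ) * Complex.I) * ω₂ / ω₁))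
        (Complex.exp (2 * (Real.pi : ℂ) * Complex.I * ω₃ / ω₁)) ≠ 0)
    (hdef3 : ∀ j k : ℕ,
      Complex.exp (-(2 * (Real.pi : ℂ) * Complex.I) * u / ω₃) *
        Complex.exp (-(2 * (Real.pi : ℂ) * Complex.I) * ω₁ / ω₃) ^ j *
        Complex.exp (-(2 * (Real.pi : ℂ) * Complex.I) * ω₂ / ω₃) ^ k ≠ 1)
    (hnz3 : ellGamma (Complex.exp (-(2 * (Real.pi : ℂ) * Complex.I) * u / ω₃))
        (Complex.exp (-(2 * (Real.pi : ℂ) * Complex.I) * ω₁ / ω₃))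
        (Complex.exp (-(2 * (Real.pi : ℂ) * Complex.I) * ω₂ / ω₃)) ≠ 0) :
    ellGamma (Complex.exp (2 * (Real.pi : ℂ) * Complex.I * u / ω₂))
        (Complex.exp (2 * (Real.pi : ℂ) * Complex.I * ω₃ / ω₂))
        (Complex.exp (2 * (Real.pi : ℂ) * Complex.I * ω₁ / ω₂)) *
      ellGamma (Complex.exp (2 * (Real.pi : ℂ) * Complex.I * ω₃ / ω₁) *
          Complex.exp (-(2 * (Real.pi : ℂ) * Complex.I) * u / ω₁))
        (Complex.exp (-(2 * (Real.pi : ℂ) * Complex.I) * ω₂ / ω₁))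
        (Complex.exp (2 * (Real.pi : ℂ) * Complex.I * ω₃ / ω₁)) =
    Complex.exp (-((Real.pi : ℂ) * Complex.I / 3) * B33 u ω₁ ω₂ ω₃) *
      ellGamma (Complex.exp (-(2 * (Real.pi : ℂ) * Complex.I) * u / ω₃))
        (Complex.exp (-(2 * (Real.pi : ℂ) * Complex.I) * ω₁ / ω₃))
        (Complex.exp (-(2 * (Real.pi : ℂ) * Complex.I) * ω₂ / ω₃)) := by
  have i21 := eg_neg_im ω₂ ω₁ him12
  have i13 := eg_neg_im ω₁ ω₃ him31
  have i23 := eg_neg_im ω₂ ω₃ him32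
  have t1 : ∀ x y : ℂ, Complex.exp (2 * (Real.pi : ℂ) * Complex.I * x / y) = egE (x / y) := by
    intro x y; unfold egE; rw [mul_div_assoc]
  have t2 : ∀ x y : ℂ, Complex.exp (-(2 * (Real.pi : ℂ) * Complex.I) * x / y) = egE (-(x / y)) := by
    intro x y; unfold egE; congr 1; ring
  have t3 : Complex.exp (-((Real.pi : ℂ) * Complex.I / 3) * B33 u ω₁ ω₂ ω₃) =
      egE (-(B33 u ω₁ ω₂ ω₃) / 6) := by
    unfold egE; congr 1; ring
  have t4 : egE (ω₃ / ω₁) * egE (-(u / ω₁)) = egE ((ω₃ - u) / ω₁) := by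
    rw [← egE_add]; congr 1; ring
  simp only [t1, t2, t3, t4] at *
  have hp := egE_norm _ him32
  have hq := egE_norm _ him12
  have hr := egE_norm _ him31
  have hq' := egE_norm _ i21
  have hr' := egE_norm _ i13
  have hp' := egE_norm _ i23
  have main := eg_entire ω₁ ω₂ ω₃ hω₁ hω₂ hω₃ him12 him31 him32 u
  rw [ellGamma_eq _ _ _ hp hq hdef1, ellGamma_eq _ _ _ hq' hr hdef2,
    ellGamma_eq _ _ _ hr' hp' hdef3]
  have n1 := egD_ne _ _ _ hp hq hdef1
  have n2 := egD_ne _ _ _ hq' hr hdef2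
  have n3 := egD_ne _ _ _ hr' hp' hdef3
  have z1 : egE (ω₃ / ω₂) * egE (ω₁ / ω₂) / egE (u / ω₂) = egE ((ω₁ + ω₃ - u) / ω₂) := by
    rw [← egE_add, ← egE_sub]; congr 1; ring
  have z2 : egE (-(ω₂ / ω₁)) * egE (ω₃ / ω₁) / egE ((ω₃ - u) / ω₁) = egE ((u - ω₂) / ω₁) := by
    rw [← egE_add, ← egE_sub]; congr 1; ring
  have z3 : egE (-(ω₁ / ω₃)) * egE (-(ω₂ / ω₃)) / egE (-(u / ω₃)) = egE ((u - ω₁ - ω₂) / ω₃) := by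
    rw [← egE_add, ← egE_sub]; congr 1; ring
  rw [z1, z2, z3, div_mul_div_comm, ← mul_div_assoc, div_eq_div_iff (mul_ne_zero n1 n2) n3]
  linear_combination main
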